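/- Let n ≥ 3 be an integer and ν ≥ (n−2)/2 real. Then there exists a constant C > 0 (depending only on n and ν) such that for all λ, r, s > 0, (rs)^{−(n−2)/2} |J_ν(λr) J_ν(λs)| ≤ C λ^{n−2} (1+λr)^{−(n−1)/2} (1+λs)^{−(n−1)/2}. -/

import Mathlib

open MeasureTheory Real Set

/-- The Bessel function of the first kind of order `ν`, defined by its power series
(with the convention `1/Γ = 0` at the poles of `Γ`). -/
noncomputable def besselJ (ν : ℝ) (x : ℝ) : ℝ :=
  ∑' k : ℕ, ((-1 : ℝ) ^ k / ((k.factorial : ℝ) * Real.Gamma (ν + (k : ℝ) + 1))) *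
    (x / 2) ^ (2 * (k : ℝ) + ν)

/-- The entire function `∑ (-t)^k / (k! Γ(ν + k + 1))`, so that
`J_ν(x) = (x/2)^ν * besselEntire ν ((x/2)^2)`. -/
noncomputable def besselEntire (ν t : ℝ) : ℝ :=
  ∑' k : ℕ, ((-1 : ℝ) ^ k / ((k.factorial : ℝ) * Real.Gamma (ν + (k : ℝ) + 1))) * t ^ k

lemma Gamma_le_Gamma_add_nat {ν : ℝ} (hν : 0 ≤ ν) (k : ℕ) :
    Real.Gamma (ν + 1) ≤ Real.Gamma (ν + (k : ℝ) + 1) := by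
  induction k with
  | zero => simp
  | succ k ih =>
    have hk : (0 : ℝ) ≤ k := k.cast_nonneg
    have hpos : 0 < Real.Gamma (ν + (k : ℝ) + 1) := Real.Gamma_pos_of_pos (by linarith)
    have h : Real.Gamma (ν + ((k + 1 : ℕ) : ℝ) + 1)
        = (ν + (k : ℝ) + 1) * Real.Gamma (ν + (k : ℝ) + 1) := by
      rw [← Real.Gamma_add_one (by linarith)]
      push_cast
      ring_nf
    rw [h]
    nlinarith [mul_nonneg (add_nonneg hν hk) hpos.le]

lemma abs_besselEntire_coeff_le {ν : ℝ} (hν : 0 ≤ ν) (k : ℕ) :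
    |(-1 : ℝ) ^ k / ((k.factorial : ℝ) * Real.Gamma (ν + (k : ℝ) + 1))|
      ≤ (Real.Gamma (ν + 1))⁻¹ * ((k.factorial : ℝ))⁻¹ := by
  have h0 : 0 < Real.Gamma (ν + 1) := Real.Gamma_pos_of_pos (by linarith)
  have h1 := Gamma_le_Gamma_add_nat hν k
  have hf : (0 : ℝ) < k.factorial := by exact_mod_cast k.factorial_pos
  have h2 : 0 < Real.Gamma (ν + (k : ℝ) + 1) := h0.trans_le h1
  rw [abs_div, abs_pow, abs_neg, abs_one, one_pow, abs_of_pos (by positivity), one_div,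
    mul_inv, mul_comm]
  gcongr

lemma summable_besselEntire {ν : ℝ} (hν : 0 ≤ ν) (t : ℝ) :
    Summable fun k : ℕ =>
      ((-1 : ℝ) ^ k / ((k.factorial : ℝ) * Real.Gamma (ν + (k : ℝ) + 1))) * t ^ k := by
  refine Summable.of_norm_bounded
    ((Real.summable_pow_div_factorial |t|).mul_left (Real.Gamma (ν + 1))⁻¹) fun k => ?_
  rw [Real.norm_eq_abs, abs_mul, abs_pow]
  calc _ ≤ ((Real.Gamma (ν + 1))⁻¹ * ((k.factorial : ℝ))⁻¹) * |t| ^ k :=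
        mul_le_mul_of_nonneg_right (abs_besselEntire_coeff_le hν k) (by positivity)
    _ = _ := by ring

lemma hasDerivAt_besselEntire {ν : ℝ} (hν : 0 ≤ ν) (t : ℝ) :
    HasDerivAt (besselEntire ν) (-besselEntire (ν + 1) t) t := by
  set c : ℕ → ℝ := fun k => (-1 : ℝ) ^ k / ((k.factorial : ℝ) * Real.Gamma (ν + (k : ℝ) + 1))
    with hc
  set R : ℝ := |t| + 1 with hR
  have hRpos : 0 < R := by positivity
  have hu : Summable fun k : ℕ =>
      (Real.Gamma (ν + 1))⁻¹ * ((k.factorial : ℝ))⁻¹ * (k * R ^ (k - 1)) := by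
    rw [← summable_nat_add_iff 1]
    refine ((Real.summable_pow_div_factorial R).mul_left (Real.Gamma (ν + 1))⁻¹).congr fun k => ?_
    have hf : (k.factorial : ℝ) ≠ 0 := by exact_mod_cast k.factorial_ne_zero
    have hk : (k : ℝ) + 1 ≠ 0 := by positivity
    rw [Nat.factorial_succ, Nat.add_sub_cancel]
    push_cast
    field_simp
  have hbound : ∀ (k : ℕ), ∀ y ∈ Metric.ball (0 : ℝ) R, ‖c k * (k * y ^ (k - 1))‖ ≤
      (Real.Gamma (ν + 1))⁻¹ * ((k.factorial : ℝ))⁻¹ * (k * R ^ (k - 1)) := by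
    intro k y hy
    have hy' : |y| ≤ R := by simpa using (mem_ball_zero_iff.mp hy).le
    have := abs_besselEntire_coeff_le hν k
    rw [Real.norm_eq_abs, abs_mul, abs_mul, abs_pow, Nat.abs_cast]
    gcongr
  have htR : t ∈ Metric.ball (0 : ℝ) R := by simp [hR]
  have h := hasDerivAt_tsum_of_isPreconnected (g := fun k y => c k * y ^ k)
    (g' := fun k y => c k * (k * y ^ (k - 1))) hu Metric.isOpen_ball
    (convex_ball (0 : ℝ) R).isPreconnected
    (fun k y _ => (hasDerivAt_pow k y).const_mul (c k)) hbound htR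
    (summable_besselEntire hν t) htR
  have hs : Summable fun k : ℕ => c k * (k * t ^ (k - 1)) :=
    Summable.of_norm_bounded hu fun k => hbound k t htR
  have hsum : ∑' k : ℕ, c k * (k * t ^ (k - 1)) = -besselEntire (ν + 1) t := by
    rw [hs.tsum_eq_zero_add, besselEntire, ← tsum_neg]
    simp only [Nat.cast_zero, zero_mul, mul_zero, zero_add]
    refine tsum_congr fun k => ?_
    have hf : (k.factorial : ℝ) ≠ 0 := by exact_mod_cast k.factorial_ne_zero
    have hk : (k : ℝ) + 1 ≠ 0 := by positivity
    have hG : Real.Gamma (ν + 1 + k + 1) ≠ 0 :=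
      (Real.Gamma_pos_of_pos (by positivity)).ne'
    have hG' : Real.Gamma (ν + (k + 1 : ℝ) + 1) = Real.Gamma (ν + 1 + k + 1) := by ring_nf
    simp only [hc]
    rw [Nat.factorial_succ, Nat.add_sub_cancel]
    push_cast
    rw [hG']
    field_simp
    ring
  rw [← hsum]
  exact h

lemma besselEntire_recurrence {ν : ℝ} (hν : 0 ≤ ν) (t : ℝ) :
    t * besselEntire (ν + 2) t = (ν + 1) * besselEntire (ν + 1) t - besselEntire ν t := by
  have h0 := summable_besselEntire hν t
  have h1 := (summable_besselEntire (show 0 ≤ ν + 1 by linarith) t).mul_left (ν + 1)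
  simp only [besselEntire]
  rw [← tsum_mul_left, ← tsum_mul_left, ← h1.tsum_sub h0, (h1.sub h0).tsum_eq_zero_add]
  have hz : (ν + 1) * ((-1 : ℝ) ^ 0 / (((0 : ℕ).factorial : ℝ) *
      Real.Gamma (ν + 1 + ((0 : ℕ) : ℝ) + 1)) * t ^ 0) -
      (-1 : ℝ) ^ 0 / (((0 : ℕ).factorial : ℝ) * Real.Gamma (ν + ((0 : ℕ) : ℝ) + 1)) * t ^ 0
      = 0 := by
    have hG : Real.Gamma (ν + 1) ≠ 0 := (Real.Gamma_pos_of_pos (by linarith)).ne'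
    have hν1 : ν + 1 ≠ 0 := by linarith
    simp only [Nat.cast_zero, add_zero, pow_zero, Nat.factorial_zero, Nat.cast_one, one_mul,
      mul_one]
    rw [Real.Gamma_add_one hν1]
    field_simp
    ring
  rw [hz, zero_add]
  refine tsum_congr fun k => ?_
  have hf : (k.factorial : ℝ) ≠ 0 := by exact_mod_cast k.factorial_ne_zero
  have hk : (k : ℝ) + 1 ≠ 0 := by positivity
  have hA : ν + k + 2 ≠ 0 := by positivity
  have hG : Real.Gamma (ν + k + 2) ≠ 0 := (Real.Gamma_pos_of_pos (by positivity)).ne'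
  have e1 : Real.Gamma (ν + 2 + k + 1) = (ν + k + 2) * Real.Gamma (ν + k + 2) := by
    rw [← Real.Gamma_add_one hA]; ring_nf
  have e2 : Real.Gamma (ν + 1 + (k + 1 : ℝ) + 1) = (ν + k + 2) * Real.Gamma (ν + k + 2) := by
    rw [← Real.Gamma_add_one hA]; ring_nf
  have e3 : Real.Gamma (ν + (k + 1 : ℝ) + 1) = Real.Gamma (ν + k + 2) := by ring_nf
  rw [Nat.factorial_succ]
  push_cast
  rw [e1, e2, e3]
  field_simp
  ring

lemma besselJ_eq_rpow_mul_besselEntire (ν : ℝ) {x : ℝ} (hx : 0 < x) :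
    besselJ ν x = (x / 2) ^ ν * besselEntire ν ((x / 2) ^ 2) := by
  rw [besselJ, besselEntire, ← tsum_mul_left]
  refine tsum_congr fun k => ?_
  have h : (x / 2) ^ (2 * (k : ℝ) + ν) = ((x / 2) ^ 2) ^ k * (x / 2) ^ ν := by
    rw [Real.rpow_add (by positivity), ← pow_mul, ← Real.rpow_natCast]
    push_cast
    rfl
  rw [h]
  ring

/-- Solutions `V` of the second-order equation with potential `4 - a / y²`, written as a first-order
system for `V` and its derivative `W`, are bounded on `[1, ∞)`: a Grönwall argument for the energy
`W² + 4 V²`. -/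
lemma exists_abs_le_of_hasDerivAt {V W : ℝ → ℝ} {a : ℝ} (ha : 0 ≤ a)
    (hV : ∀ y, 0 < y → HasDerivAt V (W y) y)
    (hW : ∀ y, 0 < y → HasDerivAt W ((a / y ^ 2 - 4) * V y) y) :
    ∃ C, ∀ y, 1 ≤ y → |V y| ≤ C := by
  set G : ℝ → ℝ := fun y => (W y ^ 2 + 4 * V y ^ 2) * Real.exp (a / 2 * y⁻¹) with hG
  have hderiv : ∀ y, 0 < y → HasDerivAt G
      (-(a / (2 * y ^ 2)) * (W y - 2 * V y) ^ 2 * Real.exp (a / 2 * y⁻¹)) y := by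
    intro y hy
    have h1 := (((hW y hy).pow 2).add (((hV y hy).pow 2).const_mul 4)).mul
      ((hasDerivAt_inv hy.ne').const_mul (a / 2)).exp
    refine h1.congr_deriv ?_
    simp only [Pi.add_apply, Pi.pow_apply]
    field_simp
    ring
  have hanti : AntitoneOn G (Ici 1) := by
    refine antitoneOn_of_deriv_nonpos (convex_Ici 1)
      (fun y hy => (hderiv y (one_pos.trans_le hy)).continuousAt.continuousWithinAt) ?_ ?_
    · intro y hy
      rw [interior_Ici] at hy
      exact (hderiv y (one_pos.trans hy)).differentiableAt.differentiableWithinAt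
    · intro y hy
      rw [interior_Ici] at hy
      rw [(hderiv y (one_pos.trans hy)).deriv, neg_mul, neg_mul, neg_nonpos]
      positivity
  refine ⟨Real.sqrt (G 1), fun y hy => Real.abs_le_sqrt ?_⟩
  have hy0 : 0 < y := one_pos.trans_le hy
  have h1 : G y ≤ G 1 := hanti self_mem_Ici hy hy
  have h2 : 1 ≤ Real.exp (a / 2 * y⁻¹) := Real.one_le_exp (by positivity)
  have h3 : W y ^ 2 + 4 * V y ^ 2 ≤ G y := le_mul_of_one_le_right (by positivity) h2
  nlinarith [sq_nonneg (W y), sq_nonneg (V y)]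

lemma exists_abs_rpow_mul_besselEntire_le {ν : ℝ} (hν : 1 / 2 ≤ ν) :
    ∃ C, ∀ y, 1 ≤ y → |y ^ (ν + 1 / 2) * besselEntire ν (y ^ 2)| ≤ C := by
  set m : ℝ := ν + 1 / 2 with hm
  have hg : ∀ κ : ℝ, 0 ≤ κ → ∀ y : ℝ, HasDerivAt (fun y => besselEntire κ (y ^ 2))
      (-besselEntire (κ + 1) (y ^ 2) * (2 * y)) y := fun κ hκ y => by
    have h := (hasDerivAt_besselEntire hκ (y ^ 2)).comp y (hasDerivAt_pow 2 y)
    simpa [Function.comp_def] using h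
  have hp : ∀ y : ℝ, 0 < y → HasDerivAt (fun y => y ^ m) (y ^ m * (m * y⁻¹)) y := fun y hy => by
    refine (Real.hasDerivAt_rpow_const (Or.inl hy.ne')).congr_deriv ?_
    rw [Real.rpow_sub_one hy.ne']
    ring
  refine exists_abs_le_of_hasDerivAt (a := m ^ 2 - m)
    (W := fun y => y ^ m * (m * y⁻¹ * besselEntire ν (y ^ 2)
      - 2 * y * besselEntire (ν + 1) (y ^ 2))) (by nlinarith) ?_ ?_
  · intro y hy
    refine ((hp y hy).mul (hg ν (by linarith) y)).congr_deriv ?_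
    ring
  · intro y hy
    have h1 := ((hasDerivAt_inv hy.ne').const_mul m).mul (hg ν (by linarith) y)
    have h2 := ((hasDerivAt_id y).const_mul 2).mul (hg (ν + 1) (by linarith) y)
    refine ((hp y hy).mul (h1.sub h2)).congr_deriv ?_
    have hrec := besselEntire_recurrence (show 0 ≤ ν by linarith) (y ^ 2)
    rw [show ν + 1 + 1 = ν + 2 by ring]
    simp only [Pi.sub_apply, Pi.mul_apply, id]
    rw [hm] at *
    field_simp
    linear_combination (16 * y ^ 2) * hrec

lemma exists_abs_besselJ_le {μ ν : ℝ} (hμ : 1 / 2 ≤ μ) (hν : μ ≤ ν) :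
    ∃ C > 0, ∀ x, 0 < x → |besselJ ν x| ≤ C * (x ^ μ * (1 + x) ^ (-(μ + 1 / 2))) := by
  obtain ⟨A, hA⟩ := exists_abs_rpow_mul_besselEntire_le (hμ.trans hν)
  have hν0 : 0 ≤ ν := by linarith
  have hcont : Continuous (besselEntire ν) :=
    continuous_iff_continuousAt.2 fun t => (hasDerivAt_besselEntire hν0 t).continuousAt
  obtain ⟨B, hB⟩ := (isCompact_Icc (a := (0 : ℝ)) (b := 1)).exists_bound_of_continuousOn
    hcont.continuousOn
  set D : ℝ := max (max A B) 1 with hD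
  have hDpos : 0 < D := lt_max_of_lt_right one_pos
  refine ⟨D * 3 ^ (μ + 1 / 2), by positivity, fun x hx => ?_⟩
  have hy : 0 < x / 2 := by positivity
  have hrhs : D * 3 ^ (μ + 1 / 2) * (x ^ μ * (1 + x) ^ (-(μ + 1 / 2)))
      = D * (x ^ μ * ((1 + x) / 3) ^ (-(μ + 1 / 2))) := by
    rw [Real.div_rpow (by positivity) (by positivity), Real.rpow_neg (by positivity : (0 : ℝ) ≤ 3)]
    field_simp
  have hxμ : (x / 2) ^ μ ≤ x ^ μ := Real.rpow_le_rpow hy.le (by linarith) (by linarith)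
  rw [hrhs, besselJ_eq_rpow_mul_besselEntire ν hx]
  rcases le_total (x / 2) 1 with h | h
  · have h1 : |besselEntire ν ((x / 2) ^ 2)| ≤ D :=
      (hB _ ⟨by positivity, pow_le_one₀ hy.le h⟩).trans
        ((le_max_right _ _).trans (le_max_left _ _))
    have h2 : (x / 2) ^ ν ≤ x ^ μ :=
      (Real.rpow_le_rpow_of_exponent_ge hy h hν).trans hxμ
    have h3 : 1 ≤ ((1 + x) / 3) ^ (-(μ + 1 / 2)) :=
      Real.one_le_rpow_of_pos_of_le_one_of_nonpos (by positivity) (by linarith) (by linarith)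
    rw [abs_mul, abs_of_pos (by positivity : 0 < (x / 2) ^ ν), mul_comm]
    exact mul_le_mul h1 (h2.trans (le_mul_of_one_le_right (by positivity) h3))
      (by positivity) hDpos.le
  · have h1 : |(x / 2) ^ (ν + 1 / 2) * besselEntire ν ((x / 2) ^ 2)| ≤ D :=
      (hA _ h).trans ((le_max_left _ _).trans (le_max_left _ _))
    have h2 : (x / 2) ^ ν * besselEntire ν ((x / 2) ^ 2) =
        ((x / 2) ^ (ν + 1 / 2) * besselEntire ν ((x / 2) ^ 2)) *
          ((x / 2) ^ μ * (x / 2) ^ (-(μ + 1 / 2))) := by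
      rw [← Real.rpow_add hy, mul_right_comm, ← Real.rpow_add hy]
      ring_nf
    have h3 : (x / 2) ^ (-(μ + 1 / 2)) ≤ ((1 + x) / 3) ^ (-(μ + 1 / 2)) :=
      Real.rpow_le_rpow_of_nonpos (by positivity) (by linarith) (by linarith)
    rw [h2, abs_mul, abs_of_pos (by positivity : 0 < (x / 2) ^ μ * (x / 2) ^ (-(μ + 1 / 2)))]
    gcongr

theorem imag_resolvent_kernel_pointwise_bound
    (n : ℕ) (hn : 3 ≤ n) (ν : ℝ) (hν : ((n : ℝ) - 2) / 2 ≤ ν) :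
    ∃ C > (0 : ℝ), ∀ lam r s : ℝ, 0 < lam → 0 < r → 0 < s →
      (r * s) ^ (-(((n : ℝ) - 2) / 2)) * |besselJ ν (lam * r) * besselJ ν (lam * s)| ≤
        C * lam ^ ((n : ℝ) - 2) * (1 + lam * r) ^ (-(((n : ℝ) - 1) / 2)) *
          (1 + lam * s) ^ (-(((n : ℝ) - 1) / 2)) := by
  have hn' : (3 : ℝ) ≤ n := by exact_mod_cast hn
  obtain ⟨C, hC, hJ⟩ := exists_abs_besselJ_le (μ := ((n : ℝ) - 2) / 2) (by linarith) hν
  refine ⟨C * C, by positivity, fun lam r s hl hr hs => ?_⟩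
  set μ : ℝ := ((n : ℝ) - 2) / 2 with hμ
  have e1 : ((n : ℝ) - 1) / 2 = μ + 1 / 2 := by rw [hμ]; ring
  have e2 : (n : ℝ) - 2 = μ + μ := by rw [hμ]; ring
  have e3 : (r * s) ^ (-μ) * ((lam * r) ^ μ * (lam * s) ^ μ) = lam ^ (μ + μ) := by
    rw [Real.rpow_neg (by positivity), Real.mul_rpow hr.le hs.le, Real.mul_rpow hl.le hr.le,
      Real.mul_rpow hl.le hs.le, Real.rpow_add hl]
    field_simp
  rw [e1, e2, ← e3, abs_mul]
  calc _ ≤ (r * s) ^ (-μ) * ((C * ((lam * r) ^ μ * (1 + lam * r) ^ (-(μ + 1 / 2)))) *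
          (C * ((lam * s) ^ μ * (1 + lam * s) ^ (-(μ + 1 / 2))))) := by
        gcongr
        · exact hJ _ (by positivity)
        · exact hJ _ (by positivity)
    _ = _ := by ring
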